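/- Let G = ([n], E) be a finite simple graph. For each integer k with 0 ≤ k ≤ n, let N_k be the number of acyclic orientations of G having exactly k source components. Then for every natural number q, the number of proper colorings of G using colors from {1, …, q} equals Σ_{k=0}^{n} (−1)^{n−k} · N_k · q^k (an identity of integers); equivalently, the coefficient of (−1)^{n−k}q^k in the chromatic polynomial of G is N_k. -/

import Mathlib

open Classical

/-- The set of vertices reachable from `i` by a directed path of `γ` (including `i`). -/
noncomputable def reachSet {n : ℕ} (γ : Fin n → Fin n → Prop) (i : Fin n) : Finset (Fin n) :=
  Finset.univ.filter fun j => Relation.ReflTransGen γ i j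

/-- `scAcc γ k` is the union `S₁ ∪ ⋯ ∪ S_k` of the first `k` source components of `γ`. -/
noncomputable def scAcc {n : ℕ} (γ : Fin n → Fin n → Prop) : ℕ → Finset (Fin n)
  | 0 => ∅
  | k + 1 =>
      if h : (Finset.univ \ scAcc γ k).Nonempty then
        scAcc γ k ∪ reachSet γ ((Finset.univ \ scAcc γ k).min' h)
      else scAcc γ k

/-- `sourceComp γ k` is the `(k+1)`-st source component `S_{k+1}` of `γ`
(so the source components of the paper are `sourceComp γ 0, sourceComp γ 1, …`). -/
noncomputable def sourceComp {n : ℕ} (γ : Fin n → Fin n → Prop) (k : ℕ) : Finset (Fin n) :=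
  scAcc γ (k + 1) \ scAcc γ k

/-- The number of (nonempty) source components of `γ`. -/
noncomputable def numSourceComps {n : ℕ} (γ : Fin n → Fin n → Prop) : ℕ :=
  ((Finset.range n).filter fun k => (sourceComp γ k).Nonempty).card

section SubsetConvolution

variable {V : Type*} [DecidableEq V]

/-- Subset convolution of integer-valued set functions. -/
def subsetConv (f g : Finset V → ℤ) (S : Finset V) : ℤ :=
  ∑ T ∈ S.powerset, f T * g (S \ T)

/-- The set function `f` restricted to the sets containing `v`; a derivation for `subsetConv`. -/
def restrictMem (v : V) (f : Finset V → ℤ) (S : Finset V) : ℤ :=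
  if v ∈ S then f S else 0

/-- The unit of `subsetConv`. -/
def convUnit (S : Finset V) : ℤ := if S = ∅ then 1 else 0

theorem subsetConv_comm (f g : Finset V → ℤ) : subsetConv f g = subsetConv g f := by
  funext S
  refine Finset.sum_bij' (fun T _ => S \ T) (fun T _ => S \ T) ?_ ?_ ?_ ?_ ?_ <;>
    intro T hT <;> rw [Finset.mem_powerset] at *
  · exact Finset.sdiff_subset
  · exact Finset.sdiff_subset
  · exact Finset.sdiff_sdiff_eq_self hT
  · exact Finset.sdiff_sdiff_eq_self hT
  · rw [Finset.sdiff_sdiff_eq_self hT, mul_comm]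

theorem subsetConv_assoc (f g h : Finset V → ℤ) :
    subsetConv (subsetConv f g) h = subsetConv f (subsetConv g h) := by
  funext S
  simp only [subsetConv, Finset.sum_mul, Finset.mul_sum]
  rw [Finset.sum_sigma', Finset.sum_sigma']
  refine Finset.sum_bij' (fun p _ => ⟨p.2, p.1 \ p.2⟩) (fun p _ => ⟨p.1 ∪ p.2, p.1⟩)
    ?_ ?_ ?_ ?_ ?_ <;> rintro ⟨A, B⟩ hp <;>
    simp only [Finset.mem_sigma, Finset.mem_powerset] at *
  · exact ⟨hp.2.trans hp.1, Finset.sdiff_subset_sdiff hp.1 subset_rfl⟩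
  · exact ⟨Finset.union_subset hp.1 (hp.2.trans Finset.sdiff_subset), Finset.subset_union_left⟩
  · rw [Finset.union_sdiff_of_subset hp.2]
  · rw [Finset.union_sdiff_cancel_left
      (Finset.disjoint_of_subset_right hp.2 Finset.disjoint_sdiff)]
  · rw [sdiff_sdiff_left, Finset.sup_eq_union, Finset.union_sdiff_of_subset hp.2, mul_assoc]

theorem convUnit_subsetConv (f : Finset V → ℤ) : subsetConv convUnit f = f := by
  funext S
  simp [subsetConv, convUnit]

theorem restrictMem_subsetConv (v : V) (f g : Finset V → ℤ) :
    restrictMem v (subsetConv f g) =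
      subsetConv (restrictMem v f) g + subsetConv f (restrictMem v g) := by
  funext S
  simp only [restrictMem, subsetConv, Pi.add_apply, ← Finset.sum_add_distrib]
  by_cases hv : v ∈ S
  · rw [if_pos hv]
    refine Finset.sum_congr rfl fun T _ => ?_
    by_cases hT : v ∈ T <;> simp [hv, hT]
  · rw [if_neg hv]
    refine (Finset.sum_eq_zero fun T hT => ?_).symm
    have : v ∉ T := fun h => hv (Finset.mem_powerset.1 hT h)
    simp [hv, this]

theorem subsetConv_smul (c : ℤ) (f g : Finset V → ℤ) :
    subsetConv f (c • g) = c • subsetConv f g := by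
  funext S
  simp [subsetConv, Finset.mul_sum, mul_left_comm]

theorem restrictMem_convUnit (v : V) : restrictMem v convUnit = 0 := by
  funext S
  simp only [restrictMem, convUnit, Pi.zero_apply]
  split_ifs with h₁ h₂ <;> simp_all

/-- Convolution powers. -/
def convPow (f : Finset V → ℤ) : ℕ → Finset V → ℤ
  | 0 => convUnit
  | q + 1 => subsetConv f (convPow f q)

/-- The logarithmic derivative of a convolution power, in terms of the convolution inverse. -/
theorem restrictMem_convPow {f g : Finset V → ℤ} (hfg : subsetConv f g = convUnit) (v : V)
    (q : ℕ) : restrictMem v (convPow f q) =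
      (-(q : ℤ)) • subsetConv (subsetConv f (restrictMem v g)) (convPow f q) := by
  have hD : restrictMem v f = (-1 : ℤ) • subsetConv f (subsetConv f (restrictMem v g)) := by
    have h := restrictMem_subsetConv v f g
    rw [hfg, restrictMem_convUnit] at h
    have h₁ : subsetConv (restrictMem v f) g = (-1 : ℤ) • subsetConv f (restrictMem v g) := by
      rw [neg_one_smul]
      exact eq_neg_of_add_eq_zero_left h.symm
    calc restrictMem v f = subsetConv f (subsetConv (restrictMem v f) g) := by
          rw [subsetConv_comm (restrictMem v f), ← subsetConv_assoc, hfg, convUnit_subsetConv]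
      _ = _ := by rw [h₁, subsetConv_smul]
  induction q with
  | zero => simp [convPow, restrictMem_convUnit]
  | succ q ih =>
    set u := subsetConv f (restrictMem v g)
    have h₁ : subsetConv (restrictMem v f) (convPow f q) =
        (-1 : ℤ) • subsetConv u (convPow f (q + 1)) := by
      rw [hD, subsetConv_comm, subsetConv_smul, subsetConv_comm, subsetConv_comm f u,
        subsetConv_assoc, convPow]
    have h₂ : subsetConv f (restrictMem v (convPow f q)) =
        (-(q : ℤ)) • subsetConv u (convPow f (q + 1)) := by
      rw [ih, subsetConv_smul, ← subsetConv_assoc, subsetConv_comm f u, subsetConv_assoc, convPow]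
    rw [convPow, restrictMem_subsetConv, h₁, h₂, ← add_smul, ← convPow]
    congr 1
    push_cast
    ring

end SubsetConvolution

section Colorings

variable {V : Type*} [Fintype V] [DecidableEq V] (G : SimpleGraph V)

/-- The indicator function of the independent sets of `G`. -/
noncomputable def indepIndicator (S : Finset V) : ℤ :=
  if ∀ a ∈ S, ∀ b ∈ S, ¬ G.Adj a b then 1 else 0

/-- Proper colorings of `G` on `S` with colors `1, …, q`, extended by `0` outside `S`. -/
noncomputable def properColorings (q : ℕ) (S : Finset V) : Finset (V → ℕ) :=
  (Fintype.piFinset fun _ => Finset.range (q + 1)).filter fun c =>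
    (∀ x, c x = 0 ↔ x ∉ S) ∧ ∀ a ∈ S, ∀ b ∈ S, G.Adj a b → c a ≠ c b

theorem mem_properColorings {q : ℕ} {S : Finset V} {c : V → ℕ} :
    c ∈ properColorings G q S ↔ (∀ x, c x ≤ q) ∧ (∀ x, c x = 0 ↔ x ∉ S) ∧
      ∀ a ∈ S, ∀ b ∈ S, G.Adj a b → c a ≠ c b := by
  simp [properColorings]

theorem card_properColorings_zero (S : Finset V) :
    ((properColorings G 0 S).card : ℤ) = convUnit S := by
  unfold convUnit
  split_ifs with h
  · subst h
    have : properColorings G 0 ∅ = {fun _ => 0} := by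
      ext c
      simp [mem_properColorings, funext_iff]
    simp [this]
  · obtain ⟨x, hx⟩ := Finset.nonempty_iff_ne_empty.2 h
    rw [Nat.cast_eq_zero, Finset.card_eq_zero, Finset.eq_empty_iff_forall_notMem]
    intro c hc
    rw [mem_properColorings] at hc
    exact (hc.2.1 x).1 (Nat.le_zero.1 (hc.1 x)) hx

theorem card_properColorings_fiber (q : ℕ) {S T : Finset V} (hT : T ⊆ S) :
    (((properColorings G (q + 1) S).filter fun c =>
      Finset.univ.filter (fun x => c x = q + 1) = T).card : ℤ) =
      indepIndicator G T * (properColorings G q (S \ T)).card := by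
  unfold indepIndicator
  split_ifs with h
  · rw [one_mul, Nat.cast_inj]
    refine Finset.card_bij' (fun c _ x => if x ∈ T then 0 else c x)
      (fun c _ x => if x ∈ T then q + 1 else c x) ?_ ?_ ?_ ?_
    · intro c hc
      simp only [Finset.mem_filter, mem_properColorings, Finset.ext_iff, Finset.mem_univ,
        true_and, Finset.mem_sdiff] at hc ⊢
      obtain ⟨⟨h₁, h₂, h₃⟩, h₄⟩ := hc
      refine ⟨fun x => ?_, fun x => ?_, fun a ha b hb hab => ?_⟩
      · have := h₁ x
        have := h₄ x
        split_ifs <;> grind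
      · have := h₂ x
        split_ifs <;> simp_all
      · simpa [ha.2, hb.2] using h₃ a ha.1 b hb.1 hab
    · intro c hc
      simp only [Finset.mem_filter, mem_properColorings, Finset.ext_iff, Finset.mem_univ,
        true_and, Finset.mem_sdiff] at hc ⊢
      obtain ⟨h₁, h₂, h₃⟩ := hc
      refine ⟨⟨fun x => ?_, fun x => ?_, fun a ha b hb hab => ?_⟩, fun x => ?_⟩
      · have := h₁ x
        split_ifs <;> omega
      · have := h₂ x
        have := @hT x
        split_ifs <;> simp_all
      · have := h₁ a
        have := h₁ b
        have := h a
        have := h₃ a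
        grind
      · have := h₁ x
        split_ifs <;> grind
    · intro c hc
      simp only [Finset.mem_filter, Finset.ext_iff, Finset.mem_univ, true_and] at hc
      funext x
      have := hc.2 x
      split_ifs <;> grind
    · intro c hc
      rw [mem_properColorings] at hc
      funext x
      have := hc.2.1 x
      simp only [Finset.mem_sdiff] at this
      split_ifs <;> grind
  · rw [zero_mul, Nat.cast_eq_zero, Finset.card_eq_zero, Finset.eq_empty_iff_forall_notMem]
    intro c hc
    rw [Finset.mem_filter, mem_properColorings] at hc
    obtain ⟨⟨-, -, h₃⟩, rfl⟩ := hc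
    refine h fun a ha b hb hab => h₃ a (hT ha) b (hT hb) hab ?_
    simp only [Finset.mem_filter, Finset.mem_univ, true_and] at ha hb
    rw [ha, hb]

theorem card_properColorings (q : ℕ) (S : Finset V) :
    ((properColorings G q S).card : ℤ) = convPow (indepIndicator G) q S := by
  induction q generalizing S with
  | zero => exact card_properColorings_zero G S
  | succ q ih =>
    rw [convPow, subsetConv, Finset.card_eq_sum_card_fiberwise
      (f := fun c => Finset.univ.filter fun x => c x = q + 1) (t := S.powerset), Nat.cast_sum]
    · refine Finset.sum_congr rfl fun T hT => ?_
      rw [card_properColorings_fiber G q (Finset.mem_powerset.1 hT), ih]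
    · intro c hc
      rw [Finset.mem_coe, mem_properColorings] at hc
      rw [Finset.mem_coe, Finset.mem_powerset]
      intro x hx
      by_contra hxS
      have := (hc.2.1 x).2 hxS
      simp [this] at hx

theorem natCard_coloring_eq (q : ℕ) :
    Nat.card {c : V → Fin q // ∀ a b, G.Adj a b → c a ≠ c b} =
      (properColorings G q Finset.univ).card := by
  rw [Nat.card_eq_fintype_card, Fintype.card_subtype]
  refine Finset.card_bij (fun c _ x => (c x : ℕ) + 1) ?_ ?_ ?_
  · intro c hc
    simp only [Finset.mem_filter, Finset.mem_univ, true_and] at hc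
    rw [mem_properColorings]
    refine ⟨fun x => (c x).2, by simp, fun a _ b _ hab h => hc a b hab ?_⟩
    exact Fin.ext (by simpa using h)
  · intro c _ d _ h
    funext x
    exact Fin.ext (by simpa using congrFun h x)
  · intro c hc
    rw [mem_properColorings] at hc
    obtain ⟨h₁, h₂, h₃⟩ := hc
    have hpos : ∀ x, c x ≠ 0 := fun x => by simp [h₂]
    refine ⟨fun x => ⟨c x - 1, by have := h₁ x; have := hpos x; omega⟩, ?_, ?_⟩
    · simp only [Finset.mem_filter, Finset.mem_univ, true_and]
      intro a b hab h
      refine h₃ a (Finset.mem_univ _) b (Finset.mem_univ _) hab ?_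
      have h := Fin.mk.inj h
      have := hpos a
      have := hpos b
      omega
    · funext x
      have := hpos x
      simp only
      omega

end Colorings

section AcyclicOrientations

variable {V : Type*}

/-- The restriction of a relation to a set of vertices. -/
def relRestrict (γ : V → V → Prop) (S : Finset V) (a b : V) : Prop := γ a b ∧ a ∈ S ∧ b ∈ S

/-- `γ` is an acyclic orientation of the subgraph of `G` induced on `S`. -/
structure IsAcyclicOrientationOn (G : SimpleGraph V) (S : Finset V) (γ : V → V → Prop) :
    Prop where
  adj : ∀ a b, γ a b → G.Adj a b ∧ a ∈ S ∧ b ∈ S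
  total : ∀ a b, G.Adj a b → a ∈ S → b ∈ S → γ a b ∨ γ b a
  acyclic : ∀ a, ¬ Relation.TransGen γ a a

namespace IsAcyclicOrientationOn

variable {G : SimpleGraph V} {S : Finset V} {γ : V → V → Prop}

theorem asymm (h : IsAcyclicOrientationOn G S γ) {a b : V} (hab : γ a b) : ¬ γ b a :=
  fun hba => h.acyclic a (.tail (.single hab) hba)

theorem relRestrict (h : IsAcyclicOrientationOn G S γ) {R : Finset V} (hR : R ⊆ S) :
    IsAcyclicOrientationOn G R (relRestrict γ R) where
  adj a b hab := ⟨(h.adj a b hab.1).1, hab.2⟩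
  total a b hab ha hb := (h.total a b hab (hR ha) (hR hb)).imp (⟨·, ha, hb⟩) (⟨·, hb, ha⟩)
  acyclic a ha := h.acyclic a (Relation.TransGen.mono (fun _ _ hab => hab.1) _ _ ha)

/-- Following edges backwards in an acyclic orientation, one meets a source. -/
theorem exists_source [Finite V] (h : IsAcyclicOrientationOn G S γ) {x : V} (hx : x ∈ S) :
    ∃ s ∈ S, (∀ a, ¬ γ a s) ∧ Relation.ReflTransGen γ s x := by
  have : IsTrans V (Relation.TransGen γ) := inferInstance
  have : Std.Irrefl (Relation.TransGen γ) := ⟨h.acyclic⟩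
  have hwf : WellFounded (Relation.TransGen γ) := Finite.wellFounded_of_trans_of_irrefl _
  induction x using hwf.induction with
  | _ x ih =>
    by_cases hsrc : ∃ a, γ a x
    · obtain ⟨a, ha⟩ := hsrc
      obtain ⟨s, hs, hs', hsa⟩ := ih a (.single ha) (h.adj a x ha).2.1
      exact ⟨s, hs, hs', hsa.tail ha⟩
    · exact ⟨x, hx, by simpa using hsrc, .refl⟩

theorem forall_reachable_iff [Finite V] (h : IsAcyclicOrientationOn G S γ) {v : V}
    (hv : v ∈ S) :
    (∀ x ∈ S, Relation.ReflTransGen γ v x) ↔ ∀ x ∈ S, x ≠ v → ∃ a, γ a x := by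
  constructor
  · intro hr x hx hxv
    obtain rfl | ⟨a, -, ha⟩ := (hr x hx).cases_tail
    · exact (hxv rfl).elim
    · exact ⟨a, ha⟩
  · intro hs x hx
    obtain ⟨s, hsS, hsrc, hsx⟩ := h.exists_source hx
    by_cases hsv : s = v
    · exact hsv ▸ hsx
    · obtain ⟨a, ha⟩ := hs s hsS hsv
      exact (hsrc a ha).elim

end IsAcyclicOrientationOn

/-- Glue relations on `R` and on `T`, directing all edges between the two sets towards `R`. -/
def glueOrientations (G : SimpleGraph V) (R T : Finset V) (γ δ : V → V → Prop) (a b : V) : Prop :=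
  γ a b ∨ δ a b ∨ (G.Adj a b ∧ a ∈ T ∧ b ∈ R)

theorem isAcyclicOrientationOn_glue {G : SimpleGraph V} [DecidableEq V] {R T : Finset V}
    (hRT : Disjoint R T) {γ δ : V → V → Prop} (hγ : IsAcyclicOrientationOn G R γ)
    (hδ : IsAcyclicOrientationOn G T δ) :
    IsAcyclicOrientationOn G (R ∪ T) (glueOrientations G R T γ δ) where
  adj a b hab := by
    rcases hab with hab | hab | hab
    · have := hγ.adj a b hab
      simp_all
    · have := hδ.adj a b hab
      simp_all
    · simp_all
  total a b hab ha hb := by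
    have h₁ := hγ.total a b hab
    have h₂ := hδ.total a b hab
    have h₃ := hab.symm
    simp only [Finset.mem_union] at ha hb
    unfold glueOrientations
    tauto
  acyclic := by
    have hdisj : ∀ x, x ∈ R → x ∉ T := fun x hx => Finset.disjoint_left.1 hRT hx
    have hleft : ∀ a b, a ∈ R → Relation.TransGen (glueOrientations G R T γ δ) a b →
        Relation.TransGen γ a b ∧ b ∈ R := by
      intro a b ha hab
      have step : ∀ x y, x ∈ R → glueOrientations G R T γ δ x y → γ x y ∧ y ∈ R := by
        intro x y hx hxy
        have h₁ := hγ.adj x y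
        have h₂ := hδ.adj x y
        have h₃ := hdisj x hx
        unfold glueOrientations at hxy
        tauto
      induction hab with
      | single h => exact ⟨.single (step _ _ ha h).1, (step _ _ ha h).2⟩
      | tail _ h ih => exact ⟨ih.1.tail (step _ _ ih.2 h).1, (step _ _ ih.2 h).2⟩
    have hright : ∀ a b, b ∈ T → Relation.TransGen (glueOrientations G R T γ δ) a b →
        Relation.TransGen δ a b ∧ a ∈ T := by
      intro a b hb hab
      have step : ∀ x y, y ∈ T → glueOrientations G R T γ δ x y → δ x y ∧ x ∈ T := by
        intro x y hy hxy
        have h₁ := hγ.adj x y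
        have h₂ := hδ.adj x y
        have h₃ := hdisj y
        unfold glueOrientations at hxy
        tauto
      induction hab using Relation.TransGen.head_induction_on with
      | single h => exact ⟨.single (step _ _ hb h).1, (step _ _ hb h).2⟩
      | head h _ ih => exact ⟨.head (step _ _ ih.2 h).1 ih.1, (step _ _ ih.2 h).2⟩
    intro a ha
    have haS : a ∈ R ∨ a ∈ T := by
      obtain ⟨b, hab, -⟩ := Relation.TransGen.head'_iff.1 ha
      have h₁ := hγ.adj a b
      have h₂ := hδ.adj a b
      unfold glueOrientations at hab
      tauto
    rcases haS with h | h
    · exact hγ.acyclic a (hleft a a h ha).1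
    · exact hδ.acyclic a (hright a a h ha).1

variable [Fintype V] [DecidableEq V] (G : SimpleGraph V)

/-- The finite set of acyclic orientations of the subgraph of `G` induced on `S`. -/
noncomputable def acyclicOrientations (S : Finset V) : Finset (V → V → Prop) :=
  Finset.univ.filter (IsAcyclicOrientationOn G S)

theorem mem_acyclicOrientations {S : Finset V} {γ : V → V → Prop} :
    γ ∈ acyclicOrientations G S ↔ IsAcyclicOrientationOn G S γ := by
  simp [acyclicOrientations]

/-- Acyclic orientations of `S` in which no edge leaves `R` are pairs of acyclic orientations
of `R` and of `S \ R`. -/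
theorem sum_acyclicOrientations_closed {R S : Finset V} (hR : R ⊆ S)
    (f g : (V → V → Prop) → ℤ) :
    ∑ γ ∈ (acyclicOrientations G S).filter (fun γ => ∀ a ∈ R, ∀ b, γ a b → b ∈ R),
      f (relRestrict γ R) * g (relRestrict γ (S \ R)) =
    (∑ γ ∈ acyclicOrientations G R, f γ) * ∑ γ ∈ acyclicOrientations G (S \ R), g γ := by
  rw [Finset.sum_mul_sum, ← Finset.sum_product']
  refine Finset.sum_bij' (fun γ _ => (relRestrict γ R, relRestrict γ (S \ R)))
    (fun p _ => glueOrientations G R (S \ R) p.1 p.2) ?_ ?_ ?_ ?_ ?_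
  · intro γ hγ
    rw [Finset.mem_filter, mem_acyclicOrientations] at hγ
    rw [Finset.mem_product, mem_acyclicOrientations, mem_acyclicOrientations]
    exact ⟨hγ.1.relRestrict hR, hγ.1.relRestrict Finset.sdiff_subset⟩
  · rintro ⟨γ, δ⟩ hp
    simp only [Finset.mem_product, mem_acyclicOrientations] at hp
    rw [Finset.mem_filter, mem_acyclicOrientations]
    refine ⟨?_, fun a ha b hab => ?_⟩
    · have := isAcyclicOrientationOn_glue Finset.disjoint_sdiff hp.1 hp.2
      rwa [Finset.union_sdiff_of_subset hR] at this
    · rcases hab with hab | hab | hab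
      · exact (hp.1.adj a b hab).2.2
      · exact ((Finset.mem_sdiff.1 (hp.2.adj a b hab).2.1).2 ha).elim
      · exact hab.2.2
  · intro γ hγ
    rw [Finset.mem_filter, mem_acyclicOrientations] at hγ
    funext a b
    have h₁ := hγ.1.adj a b
    have h₂ := hγ.1.total a b
    have h₃ := hγ.2 b
    have h₄ := hγ.2 a
    simp only [glueOrientations, relRestrict, Finset.mem_sdiff, eq_iff_iff]
    have h₅ := @hR a
    have h₆ := @hR b
    grind
  · rintro ⟨γ, δ⟩ hp
    simp only [Finset.mem_product, mem_acyclicOrientations] at hp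
    refine Prod.ext ?_ ?_ <;> funext a b <;>
    · have h₁ := hp.1.adj a b
      have h₂ := hp.2.adj a b
      simp only [glueOrientations, relRestrict, Finset.mem_sdiff, eq_iff_iff] at *
      tauto
  · intro γ _
    rfl

theorem sum_acyclicOrientations_eq_bot (T : Finset V) :
    (∑ γ ∈ acyclicOrientations G T, if ∀ a b, ¬ γ a b then (1 : ℤ) else 0) =
      indepIndicator G T := by
  unfold indepIndicator
  split_ifs with h
  · rw [Finset.sum_eq_single_of_mem (fun _ _ => False)]
    · simp
    · rw [mem_acyclicOrientations]
      refine ⟨by simp, fun a b hab ha hb => (h a ha b hb hab).elim, fun a ha => ?_⟩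
      obtain ⟨b, hab, -⟩ := Relation.TransGen.head'_iff.1 ha
      exact hab
    · intro γ _ hne
      refine if_neg fun hγ => hne ?_
      funext a b
      simpa using hγ a b
  · refine Finset.sum_eq_zero fun γ hγ => if_neg fun hbot => h fun a ha b hb hab => ?_
    rw [mem_acyclicOrientations] at hγ
    have := hγ.total a b hab ha hb
    have := hbot a b
    have := hbot b a
    tauto

theorem card_filter_sources_superset {S T : Finset V} (hT : T ⊆ S) :
    (((acyclicOrientations G S).filter fun γ => ∀ w ∈ T, ∀ a, ¬ γ a w).card : ℤ) =
      indepIndicator G T * (acyclicOrientations G (S \ T)).card := by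
  have h := sum_acyclicOrientations_closed G (Finset.sdiff_subset (s := S) (t := T))
    (fun _ => 1) (fun γ => if ∀ a b, ¬ γ a b then 1 else 0)
  rw [Finset.sdiff_sdiff_eq_self hT, sum_acyclicOrientations_eq_bot, Finset.sum_const,
    nsmul_eq_mul, mul_one, mul_comm] at h
  rw [← h]
  simp only [one_mul]
  rw [Finset.sum_boole, Nat.cast_inj, Finset.filter_filter]
  congr 1
  refine Finset.filter_congr fun γ hγ => ?_
  rw [mem_acyclicOrientations] at hγ
  constructor
  · intro hs
    refine ⟨fun a _ b hab => Finset.mem_sdiff.2 ⟨(hγ.adj a b hab).2.2, fun hb => hs b hb a hab⟩,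
      fun a b hab => hs b hab.2.2 a hab.1⟩
  · rintro ⟨h₁, h₂⟩ w hw a haw
    by_cases ha : a ∈ T
    · exact h₂ a w ⟨haw, ha, hw⟩
    · exact (Finset.mem_sdiff.1 (h₁ a (Finset.mem_sdiff.2 ⟨(hγ.adj a w haw).2.1, ha⟩) w haw)).2 hw

/-- Inclusion-exclusion for the acyclic orientations of `S` without sources in `W`. -/
theorem sum_indepIndicator_mul_card {S W : Finset V} (hW : W ⊆ S) :
    ∑ T ∈ W.powerset, (-1 : ℤ) ^ T.card *
      (indepIndicator G T * (acyclicOrientations G (S \ T)).card) =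
    ((acyclicOrientations G S).filter fun γ => ∀ w ∈ W, ∃ a, γ a w).card := by
  calc _ = ∑ T ∈ W.powerset, ∑ γ ∈ acyclicOrientations G S,
        if ∀ w ∈ T, ∀ a, ¬ γ a w then (-1 : ℤ) ^ T.card else 0 := by
        refine Finset.sum_congr rfl fun T hT => ?_
        rw [← card_filter_sources_superset G ((Finset.mem_powerset.1 hT).trans hW),
          ← Finset.sum_filter, Finset.sum_const, nsmul_eq_mul, mul_comm]
    _ = ∑ γ ∈ acyclicOrientations G S, if ∀ w ∈ W, ∃ a, γ a w then (1 : ℤ) else 0 := by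
        rw [Finset.sum_comm]
        refine Finset.sum_congr rfl fun γ _ => ?_
        rw [← Finset.sum_filter]
        have : W.powerset.filter (fun T => ∀ w ∈ T, ∀ a, ¬ γ a w) =
            (W.filter fun w => ∀ a, ¬ γ a w).powerset := by
          ext T
          simp only [Finset.mem_filter, Finset.mem_powerset, Finset.subset_iff]
          grind
        rw [this, Finset.sum_powerset_neg_one_pow_card]
        congr 1
        simp [Finset.filter_eq_empty_iff]
    _ = _ := by rw [Finset.sum_boole]

/-- The signed number of acyclic orientations of the induced subgraphs of `G`. -/
noncomputable def signedAcyclicCount (S : Finset V) : ℤ :=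
  (-1) ^ S.card * (acyclicOrientations G S).card

theorem indepIndicator_mul_signedAcyclicCount {S T : Finset V} (hT : T ⊆ S) :
    indepIndicator G T * signedAcyclicCount G (S \ T) = (-1) ^ S.card *
      ((-1) ^ T.card * (indepIndicator G T * (acyclicOrientations G (S \ T)).card)) := by
  have h : (-1 : ℤ) ^ S.card * (-1) ^ T.card = (-1) ^ (S \ T).card := by
    rw [← Finset.card_sdiff_add_card_eq_card hT, pow_add, mul_assoc, ← mul_pow]
    simp
  rw [signedAcyclicCount, ← h]
  ring

theorem subsetConv_indepIndicator_signedAcyclicCount :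
    subsetConv (indepIndicator G) (signedAcyclicCount G) = convUnit := by
  funext S
  rw [subsetConv, Finset.sum_congr rfl fun T hT =>
    indepIndicator_mul_signedAcyclicCount G (Finset.mem_powerset.1 hT), ← Finset.mul_sum,
    sum_indepIndicator_mul_card G subset_rfl, convUnit]
  split_ifs with h
  · subst h
    have : acyclicOrientations G ∅ = {fun _ _ => False} := by
      ext γ
      rw [mem_acyclicOrientations, Finset.mem_singleton]
      constructor
      · intro h
        funext a b
        have := h.adj a b
        simp_all
      · rintro rfl
        refine ⟨by simp, by simp, fun a ha => ?_⟩
        obtain ⟨b, hab, -⟩ := Relation.TransGen.head'_iff.1 ha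
        exact hab
    simp [this]
  · obtain ⟨x, hx⟩ := Finset.nonempty_iff_ne_empty.2 h
    rw [Finset.filter_false_of_mem]
    · simp
    · intro γ hγ hno
      rw [mem_acyclicOrientations] at hγ
      obtain ⟨s, hs, hsrc, -⟩ := hγ.exists_source hx
      obtain ⟨a, ha⟩ := hno s hs
      exact hsrc a ha

/-- The acyclic orientations of `S` in which every vertex is reachable from `v`. -/
noncomputable def rootedOrientations (v : V) (S : Finset V) : Finset (V → V → Prop) :=
  (acyclicOrientations G S).filter fun γ => ∀ x ∈ S, Relation.ReflTransGen γ v x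

theorem subsetConv_indepIndicator_restrictMem (v : V) {S : Finset V} (hv : v ∈ S) :
    subsetConv (indepIndicator G) (restrictMem v (signedAcyclicCount G)) S =
      (-1) ^ S.card * (rootedOrientations G v S).card := by
  have hsum : subsetConv (indepIndicator G) (restrictMem v (signedAcyclicCount G)) S =
      ∑ T ∈ (S.erase v).powerset, indepIndicator G T * signedAcyclicCount G (S \ T) := by
    have : (S.erase v).powerset = S.powerset.filter (v ∉ ·) := by
      ext T
      simp [Finset.subset_erase]
    rw [subsetConv, this, Finset.sum_filter]
    refine Finset.sum_congr rfl fun T _ => ?_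
    simp [restrictMem, hv]
  rw [hsum, Finset.sum_congr rfl fun T hT => indepIndicator_mul_signedAcyclicCount G
    ((Finset.mem_powerset.1 hT).trans (Finset.erase_subset v S)), ← Finset.mul_sum,
    sum_indepIndicator_mul_card G (Finset.erase_subset v S), rootedOrientations]
  congr 3
  refine Finset.filter_congr fun γ hγ => ?_
  rw [((mem_acyclicOrientations G).1 hγ).forall_reachable_iff hv]
  simp only [Finset.mem_erase]
  grind

end AcyclicOrientations

section SourceComponents

/-- The vertices of `S` reachable from `v` by a directed path inside `S`. -/
noncomputable def reachIn {V : Type*} (γ : V → V → Prop) (S : Finset V) (v : V) : Finset V :=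
  S.filter (Relation.ReflTransGen (relRestrict γ S) v)

theorem mem_reachIn {V : Type*} {γ : V → V → Prop} {S : Finset V} {v x : V} :
    x ∈ reachIn γ S v ↔ x ∈ S ∧ Relation.ReflTransGen (relRestrict γ S) v x := by
  simp [reachIn]

theorem self_mem_reachIn {V : Type*} {γ : V → V → Prop} {S : Finset V} {v : V} (hv : v ∈ S) :
    v ∈ reachIn γ S v :=
  mem_reachIn.2 ⟨hv, .refl⟩

theorem reachIn_subset {V : Type*} (γ : V → V → Prop) (S : Finset V) (v : V) :
    reachIn γ S v ⊆ S :=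
  Finset.filter_subset _ _

theorem sdiff_reachIn_ssubset {V : Type*} [DecidableEq V] (γ : V → V → Prop) {S : Finset V}
    {v : V} (hv : v ∈ S) : S \ reachIn γ S v ⊂ S :=
  Finset.sdiff_ssubset (reachIn_subset γ S v) ⟨v, self_mem_reachIn hv⟩

theorem reachIn_eq_iff {V : Type*} [DecidableEq V] {G : SimpleGraph V} {R S : Finset V}
    {γ : V → V → Prop}
    (hγ : IsAcyclicOrientationOn G S γ) {v : V} (hv : v ∈ S) (hR : R ⊆ S) :
    reachIn γ S v = R ↔ (∀ a ∈ R, ∀ b, γ a b → b ∈ R) ∧ v ∈ R ∧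
      ∀ x ∈ R, Relation.ReflTransGen (relRestrict γ R) v x := by
  constructor
  · rintro rfl
    have hcl : ∀ a ∈ reachIn γ S v, ∀ b, γ a b → b ∈ reachIn γ S v := by
      intro a ha b hab
      rw [mem_reachIn] at ha ⊢
      have := (hγ.adj a b hab).2
      exact ⟨this.2, ha.2.tail ⟨hab, this⟩⟩
    refine ⟨hcl, self_mem_reachIn hv, fun x hx => ?_⟩
    suffices ∀ x, Relation.ReflTransGen (relRestrict γ S) v x → x ∈ reachIn γ S v ∧
        Relation.ReflTransGen (relRestrict γ (reachIn γ S v)) v x from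
      (this x (mem_reachIn.1 hx).2).2
    intro x hx
    induction hx with
    | refl => exact ⟨self_mem_reachIn hv, .refl⟩
    | tail _ hyz ih =>
      have hz := hcl _ ih.1 _ hyz.1
      exact ⟨hz, ih.2.tail ⟨hyz.1, ih.1, hz⟩⟩
  · rintro ⟨hcl, hvR, hreach⟩
    ext x
    rw [mem_reachIn]
    constructor
    · rintro ⟨-, hx⟩
      induction hx with
      | refl => exact hvR
      | tail _ hyz ih => exact hcl _ ih _ hyz.1
    · exact fun hx => ⟨hR hx, Relation.ReflTransGen.mono
        (fun a b hab => ⟨hab.1, hR hab.2.1, hR hab.2.2⟩) _ _ (hreach x hx)⟩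

theorem sum_filter_reachIn_eq {V : Type*} [Fintype V] [DecidableEq V] (G : SimpleGraph V)
    {R S : Finset V} {v : V} (hv : v ∈ S) (hR : R ⊆ S) (f : (V → V → Prop) → ℤ) :
    ∑ γ ∈ (acyclicOrientations G S).filter (fun γ => reachIn γ S v = R),
      f (relRestrict γ (S \ R)) =
    (if v ∈ R then ((rootedOrientations G v R).card : ℤ) else 0) *
      ∑ γ ∈ acyclicOrientations G (S \ R), f γ := by
  have hroot : (∑ γ ∈ acyclicOrientations G R,
      if v ∈ R ∧ ∀ x ∈ R, Relation.ReflTransGen γ v x then (1 : ℤ) else 0) =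
      if v ∈ R then ((rootedOrientations G v R).card : ℤ) else 0 := by
    by_cases hvR : v ∈ R <;> simp [hvR, rootedOrientations]
  rw [← hroot, ← sum_acyclicOrientations_closed G hR]
  simp only [ite_mul, one_mul, zero_mul]
  rw [← Finset.sum_filter, Finset.filter_filter]
  refine Finset.sum_congr (Finset.filter_congr fun γ hγ => ?_) fun γ hγ => rfl
  exact reachIn_eq_iff ((mem_acyclicOrientations G).1 hγ) hv hR

variable {n : ℕ}

/-- The number of source components of the restriction of `γ` to `S`. -/
noncomputable def compCount (γ : Fin n → Fin n → Prop) (S : Finset (Fin n)) : ℕ :=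
  if h : S.Nonempty then compCount γ (S \ reachIn γ S (S.min' h)) + 1 else 0
termination_by S.card
decreasing_by
  exact Finset.card_lt_card (sdiff_reachIn_ssubset γ (S.min'_mem h))

theorem compCount_of_nonempty (γ : Fin n → Fin n → Prop) {S : Finset (Fin n)} (h : S.Nonempty) :
    compCount γ S = compCount γ (S \ reachIn γ S (S.min' h)) + 1 := by
  rw [compCount, dif_pos h]

theorem compCount_empty (γ : Fin n → Fin n → Prop) : compCount γ ∅ = 0 := by
  rw [compCount, dif_neg Finset.not_nonempty_empty]

theorem compCount_le_card (γ : Fin n → Fin n → Prop) (S : Finset (Fin n)) :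
    compCount γ S ≤ S.card := by
  induction S using Finset.strongInduction with
  | H S ih =>
    by_cases h : S.Nonempty
    · have hlt := sdiff_reachIn_ssubset γ (S.min'_mem h)
      rw [compCount_of_nonempty γ h]
      exact (ih _ hlt).trans_lt (Finset.card_lt_card hlt)
    · rw [Finset.not_nonempty_iff_eq_empty.1 h, compCount_empty]
      simp

theorem relRestrict_relRestrict {V : Type*} (γ : V → V → Prop) {S T : Finset V} (hT : T ⊆ S) :
    relRestrict (relRestrict γ S) T = relRestrict γ T := by
  funext a b
  have := @hT a
  have := @hT b
  simp only [relRestrict, eq_iff_iff]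
  tauto

theorem compCount_relRestrict (γ : Fin n → Fin n → Prop) {S T : Finset (Fin n)} (hT : T ⊆ S) :
    compCount (relRestrict γ S) T = compCount γ T := by
  induction T using Finset.strongInduction with
  | H T ih =>
    by_cases h : T.Nonempty
    · have hlt := sdiff_reachIn_ssubset γ (T.min'_mem h)
      have hr : reachIn (relRestrict γ S) T (T.min' h) = reachIn γ T (T.min' h) := by
        rw [reachIn, reachIn, relRestrict_relRestrict γ hT]
      rw [compCount_of_nonempty _ h, compCount_of_nonempty _ h, hr,
        ih _ hlt (hlt.subset.trans hT)]
    · rw [Finset.not_nonempty_iff_eq_empty.1 h, compCount_empty, compCount_empty]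

theorem scAcc_closed (γ : Fin n → Fin n → Prop) (k : ℕ) {a b : Fin n} (ha : a ∈ scAcc γ k)
    (hab : γ a b) : b ∈ scAcc γ k := by
  induction k with
  | zero => simp [scAcc] at ha
  | succ k ih =>
    rw [scAcc] at ha ⊢
    split_ifs at ha ⊢ with h
    · rw [Finset.mem_union] at ha ⊢
      refine ha.imp ih fun ha => ?_
      simp only [reachSet, Finset.mem_filter, Finset.mem_univ, true_and] at ha ⊢
      exact ha.tail hab
    · exact ih ha

theorem univ_sdiff_scAcc_succ (γ : Fin n → Fin n → Prop) (k : ℕ)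
    (h : (Finset.univ \ scAcc γ k).Nonempty) :
    Finset.univ \ scAcc γ (k + 1) = (Finset.univ \ scAcc γ k) \
      reachIn γ (Finset.univ \ scAcc γ k) ((Finset.univ \ scAcc γ k).min' h) := by
  have key : ∀ m x, Relation.ReflTransGen γ m x → x ∉ scAcc γ k →
      Relation.ReflTransGen (relRestrict γ (Finset.univ \ scAcc γ k)) m x := by
    intro m x hmx
    induction hmx with
    | refl => exact fun _ => .refl
    | @tail y z _ hyz ih =>
      intro hz
      have hy : y ∉ scAcc γ k := fun hy => hz (scAcc_closed γ k hy hyz)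
      exact (ih hy).tail ⟨hyz, by simpa using hy, by simpa using hz⟩
  ext x
  rw [scAcc, dif_pos h]
  simp only [Finset.mem_sdiff, Finset.mem_univ, true_and, Finset.mem_union, reachSet,
    Finset.mem_filter, mem_reachIn, not_or, not_and]
  refine and_congr_right fun hx => ⟨fun hr _ hr' => hr
    (Relation.ReflTransGen.mono (fun _ _ hab => hab.1) _ _ hr'), ?_⟩
  exact fun hr hr' => hr hx (key _ _ hr' hx)

theorem sourceComp_nonempty_iff (γ : Fin n → Fin n → Prop) (k : ℕ) :
    (sourceComp γ k).Nonempty ↔ (Finset.univ \ scAcc γ k).Nonempty := by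
  constructor
  · rintro ⟨x, hx⟩
    exact ⟨x, by simpa using (Finset.mem_sdiff.1 hx).2⟩
  · intro h
    refine ⟨_, Finset.mem_sdiff.2 ⟨?_, (Finset.mem_sdiff.1 (Finset.min'_mem _ h)).2⟩⟩
    rw [scAcc, dif_pos h]
    exact Finset.mem_union_right _ (by simp [reachSet, Relation.ReflTransGen.refl])

theorem card_univ_sdiff_scAcc_le (γ : Fin n → Fin n → Prop) (k : ℕ) :
    (Finset.univ \ scAcc γ k).card ≤ n - k := by
  induction k with
  | zero => simp [scAcc]
  | succ k ih =>
    by_cases h : (Finset.univ \ scAcc γ k).Nonempty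
    · rw [univ_sdiff_scAcc_succ γ k h]
      have hlt := Finset.card_lt_card (sdiff_reachIn_ssubset γ (Finset.min'_mem _ h))
      omega
    · rw [scAcc, dif_neg h, Finset.not_nonempty_iff_eq_empty.1 h]
      simp

theorem compCount_univ_eq (γ : Fin n → Fin n → Prop) (k : ℕ) :
    compCount γ Finset.univ =
      ((Finset.range k).filter fun j => (sourceComp γ j).Nonempty).card +
        compCount γ (Finset.univ \ scAcc γ k) := by
  induction k with
  | zero => simp [scAcc]
  | succ k ih =>
    rw [ih, Finset.range_add_one, Finset.filter_insert]
    split_ifs with h <;> rw [sourceComp_nonempty_iff] at h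
    · rw [Finset.card_insert_of_notMem (by simp), compCount_of_nonempty γ h,
        univ_sdiff_scAcc_succ γ k h]
      ring
    · rw [scAcc, dif_neg h]

theorem numSourceComps_eq_compCount (γ : Fin n → Fin n → Prop) :
    numSourceComps γ = compCount γ Finset.univ := by
  have h := card_univ_sdiff_scAcc_le γ n
  rw [Nat.sub_self, Nat.le_zero, Finset.card_eq_zero] at h
  rw [compCount_univ_eq γ n, h, compCount_empty, numSourceComps, add_zero]

variable (G : SimpleGraph (Fin n))

/-- The signed generating function of acyclic orientations by number of source components. -/
noncomputable def sourceCompSum (q : ℤ) (S : Finset (Fin n)) : ℤ :=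
  (-1) ^ S.card * ∑ γ ∈ acyclicOrientations G S, (-q) ^ compCount γ S

theorem sourceCompSum_eq_subsetConv (q : ℤ) {S : Finset (Fin n)} (h : S.Nonempty) :
    sourceCompSum G q S = -q * subsetConv (subsetConv (indepIndicator G)
      (restrictMem (S.min' h) (signedAcyclicCount G))) (sourceCompSum G q) S := by
  rw [sourceCompSum, ← Finset.sum_fiberwise_of_maps_to (t := S.powerset)
    (g := fun γ => reachIn γ S (S.min' h))
    fun γ _ => Finset.mem_powerset.2 (reachIn_subset _ _ _), subsetConv,
    Finset.mul_sum, Finset.mul_sum]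
  refine Finset.sum_congr rfl fun R hR => ?_
  rw [Finset.mem_powerset] at hR
  have hstep : ∀ γ ∈ (acyclicOrientations G S).filter (fun γ => reachIn γ S (S.min' h) = R),
      (-q) ^ compCount γ S = -q * (-q) ^ compCount (relRestrict γ (S \ R)) (S \ R) := by
    intro γ hγ
    rw [compCount_relRestrict γ subset_rfl, compCount_of_nonempty γ h,
      (Finset.mem_filter.1 hγ).2, pow_succ']
  rw [Finset.sum_congr rfl hstep, ← Finset.mul_sum,
    sum_filter_reachIn_eq G (S.min'_mem h) hR fun γ => (-q) ^ compCount γ (S \ R), sourceCompSum]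
  split_ifs with hvR
  · rw [subsetConv_indepIndicator_restrictMem G _ hvR,
      ← Finset.card_sdiff_add_card_eq_card hR, pow_add]
    ring
  · have : subsetConv (indepIndicator G) (restrictMem (S.min' h) (signedAcyclicCount G)) R = 0 :=
      Finset.sum_eq_zero fun T _ => by simp [restrictMem, hvR]
    rw [this]
    ring

theorem sourceCompSum_eq_convPow (q : ℕ) (S : Finset (Fin n)) :
    sourceCompSum G q S = convPow (indepIndicator G) q S := by
  have hinv := subsetConv_indepIndicator_signedAcyclicCount G
  induction S using Finset.strongInduction with
  | H S ih =>
    by_cases h : S.Nonempty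
    · have hv := S.min'_mem h
      have hD := congrFun (restrictMem_convPow hinv (S.min' h) q) S
      rw [restrictMem, if_pos hv, Pi.smul_apply, smul_eq_mul] at hD
      rw [sourceCompSum_eq_subsetConv G q h, hD, subsetConv, subsetConv]
      congr 1
      refine Finset.sum_congr rfl fun R hR => ?_
      rw [Finset.mem_powerset] at hR
      by_cases hvR : S.min' h ∈ R
      · rw [ih _ (Finset.sdiff_ssubset hR ⟨_, hvR⟩)]
      · have : subsetConv (indepIndicator G)
            (restrictMem (S.min' h) (signedAcyclicCount G)) R = 0 :=
          Finset.sum_eq_zero fun T _ => by simp [restrictMem, hvR]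
        rw [this, zero_mul, zero_mul]
    · rw [Finset.not_nonempty_iff_eq_empty.1 h]
      have h₀ : convPow (indepIndicator G) q ∅ = 1 := by
        induction q with
        | zero => simp [convPow, convUnit]
        | succ q ihq =>
          simp_all [convPow, subsetConv, indepIndicator]
      have h₁ := congrFun hinv ∅
      simp only [subsetConv, Finset.powerset_empty, Finset.sum_singleton, indepIndicator,
        signedAcyclicCount, convUnit] at h₁
      rw [h₀, sourceCompSum]
      simpa [compCount_empty] using h₁

theorem natCard_orientations_eq (k : ℕ) :
    Nat.card {γ : Fin n → Fin n → Prop //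
      (∀ a b, γ a b → G.Adj a b) ∧ (∀ a b, G.Adj a b → (γ a b ↔ ¬ γ b a)) ∧
      (∀ a, ¬ Relation.TransGen γ a a) ∧ numSourceComps γ = k} =
    ((acyclicOrientations G Finset.univ).filter
      fun γ => compCount γ Finset.univ = k).card := by
  rw [Nat.card_eq_fintype_card, Fintype.card_subtype]
  congr 1
  ext γ
  simp only [Finset.mem_filter, Finset.mem_univ, true_and, mem_acyclicOrientations,
    numSourceComps_eq_compCount]
  constructor
  · rintro ⟨h₁, h₂, h₃, h₄⟩
    refine ⟨⟨fun a b hab => by simpa using h₁ a b hab, fun a b hab _ _ => ?_, h₃⟩, h₄⟩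
    have := h₂ a b hab
    tauto
  · rintro ⟨h, hk⟩
    refine ⟨fun a b hab => (h.adj a b hab).1, fun a b hab => ⟨h.asymm, fun hba => ?_⟩,
      h.acyclic, hk⟩
    exact (h.total a b hab (Finset.mem_univ _) (Finset.mem_univ _)).resolve_right hba

end SourceComponents

/-- Greene–Zaslavsky: the number of proper `q`-colorings of `G` equals
`∑_{k=0}^{n} (−1)^{n−k} N_k q^k`, where `N_k` is the number of acyclic orientations of `G`
with exactly `k` source components. -/
theorem chromatic_poly_source_components {n : ℕ} (G : SimpleGraph (Fin n)) (q : ℕ) :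
    (Nat.card {c : Fin n → Fin q // ∀ a b : Fin n, G.Adj a b → c a ≠ c b} : ℤ) =
      ∑ k ∈ Finset.range (n + 1),
        (-1 : ℤ) ^ (n - k) *
          (Nat.card {γ : Fin n → Fin n → Prop //
              (∀ a b, γ a b → G.Adj a b) ∧
              (∀ a b, G.Adj a b → (γ a b ↔ ¬ γ b a)) ∧
              (∀ a, ¬ Relation.TransGen γ a a) ∧
              numSourceComps γ = k} : ℤ) * (q : ℤ) ^ k := by

  rw [natCard_coloring_eq, card_properColorings, ← sourceCompSum_eq_convPow, sourceCompSum,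
    ← Finset.sum_fiberwise_of_maps_to (t := Finset.range (n + 1))
      (g := fun γ => compCount γ Finset.univ) (fun γ _ => ?_), Finset.mul_sum]
  · refine Finset.sum_congr rfl fun k hk => ?_
    have hkn : k ≤ n := Nat.lt_succ_iff.1 (Finset.mem_range.1 hk)
    rw [natCard_orientations_eq, Finset.sum_congr rfl fun γ hγ => by
      rw [(Finset.mem_filter.1 hγ).2], Finset.sum_const, nsmul_eq_mul, Finset.card_univ,
      Fintype.card_fin, neg_pow (q : ℤ)]
    have hsign : (-1 : ℤ) ^ n * (-1) ^ k = (-1) ^ (n - k) := by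
      obtain ⟨m, rfl⟩ := Nat.exists_eq_add_of_le' hkn
      rw [Nat.add_sub_cancel, pow_add, mul_assoc, ← mul_pow]
      simp
    rw [← hsign]
    ring
  · have := compCount_le_card γ Finset.univ
    rw [Finset.card_univ, Fintype.card_fin] at this
    exact Finset.mem_range.2 (Nat.lt_succ_iff.2 this)
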